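/- For the synthetic symmetric TPM on N = 2ⁿ states with parameter x ∈ (0,1) (rows are n-fold Bernoulli(x) products centered at distinct states forming a group structure so that the average row is uniform), degeneracy = 0 and EI = n·(1 + (1-x)log₂(1-x) + x·log₂(x)). -/

import Mathlib

open Real Finset

/-- Hamming distance between two states of {0,1}ⁿ. -/
def hamming {n : ℕ} (s s' : Fin n → Bool) : ℕ :=
  (Finset.univ.filter (fun j => s j ≠ s' j)).card

/-- The synthetic symmetric TPM: P(s'|s) = x^(n−d(s,s'))·(1−x)^(d(s,s')). -/
noncomputable def synTPM (n : ℕ) (x : ℝ) (s s' : Fin n → Bool) : ℝ :=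
  x ^ (n - hamming s s') * (1 - x) ^ (hamming s s')

/-- KL divergence (in bits) against the uniform distribution on {0,1}ⁿ. -/
noncomputable def klU {n : ℕ} (p : (Fin n → Bool) → ℝ) : ℝ :=
  ∑ s, p s * Real.logb 2 (p s / (1 / (Fintype.card (Fin n → Bool) : ℝ)))

/-- Hoel's determinism coefficient. -/
noncomputable def determinism {n : ℕ} (T : (Fin n → Bool) → (Fin n → Bool) → ℝ) : ℝ :=
  (1 / (Fintype.card (Fin n → Bool) : ℝ)) *
    ∑ s, klU (T s) / Real.logb 2 (Fintype.card (Fin n → Bool))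

/-- Hoel's degeneracy coefficient. -/
noncomputable def degeneracy {n : ℕ} (T : (Fin n → Bool) → (Fin n → Bool) → ℝ) : ℝ :=
  klU (fun s' => (∑ s, T s s') / (Fintype.card (Fin n → Bool) : ℝ)) /
    Real.logb 2 (Fintype.card (Fin n → Bool))

/-- Effective Information. -/
noncomputable def EI {n : ℕ} (T : (Fin n → Bool) → (Fin n → Bool) → ℝ) : ℝ :=
  Real.logb 2 (Fintype.card (Fin n → Bool)) * (determinism T - degeneracy T)

/-- Expectation of a sum of single-coordinate functions under a product distribution. -/
theorem sum_prod_mul_sum_eq {ι κ : Type*} [Fintype ι] [DecidableEq ι] [Fintype κ]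
    (p f : ι → κ → ℝ) (hp : ∀ i, ∑ b, p i b = 1) :
    ∑ s : ι → κ, (∏ i, p i (s i)) * ∑ j, f j (s j) = ∑ j, ∑ b, p j b * f j b := by
  simp_rw [Finset.mul_sum]
  rw [Finset.sum_comm]
  refine Finset.sum_congr rfl fun j _ => ?_
  have hfactor : ∀ s : ι → κ, (∏ i, p i (s i)) * f j (s j) =
      ∏ i, p i (s i) * (if i = j then f i (s i) else 1) := fun s => by
    rw [Finset.prod_mul_distrib, Finset.prod_ite_eq' Finset.univ j fun i => f i (s i)]
    simp
  simp_rw [hfactor]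
  rw [← Fintype.prod_sum fun i b => p i b * (if i = j then f i b else 1)]
  rw [Finset.prod_eq_single j]
  · simp
  · intro i _ hij
    simp [hij, hp]
  · simp

/-- Transition probability of a single bit: it is kept with probability `x`. -/
noncomputable def bitKernel (x : ℝ) (a b : Bool) : ℝ := if a ≠ b then 1 - x else x

theorem bitKernel_pos {x : ℝ} (hx : x ∈ Set.Ioo (0 : ℝ) 1) (a b : Bool) :
    0 < bitKernel x a b := by
  unfold bitKernel
  split_ifs
  · exact sub_pos.mpr hx.2
  · exact hx.1

theorem sum_bitKernel (x : ℝ) (a : Bool) : ∑ b, bitKernel x a b = 1 := by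
  cases a <;> simp [bitKernel]

theorem synTPM_eq_prod (n : ℕ) (x : ℝ) (s s' : Fin n → Bool) :
    synTPM n x s s' = ∏ j, bitKernel x (s j) (s' j) := by
  have hcard := Finset.card_filter_add_card_filter_not (s := (Finset.univ : Finset (Fin n)))
    (fun j => s j ≠ s' j)
  rw [Finset.card_univ, Fintype.card_fin] at hcard
  unfold synTPM hamming bitKernel
  rw [Finset.prod_ite, Finset.prod_const, Finset.prod_const, mul_comm]
  congr 2
  omega

theorem synTPM_comm (n : ℕ) (x : ℝ) (s s' : Fin n → Bool) :
    synTPM n x s s' = synTPM n x s' s := by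
  simp only [synTPM, hamming, ne_comm]

theorem sum_synTPM_row (n : ℕ) (x : ℝ) (s : Fin n → Bool) : ∑ s', synTPM n x s s' = 1 := by
  simp_rw [synTPM_eq_prod]
  rw [← Fintype.prod_sum fun j b => bitKernel x (s j) b]
  simp only [sum_bitKernel, Finset.prod_const_one]

theorem sum_synTPM_column (n : ℕ) (x : ℝ) (s' : Fin n → Bool) :
    ∑ s, synTPM n x s s' = 1 := by
  simp_rw [synTPM_comm n x _ s', sum_synTPM_row]

theorem logb_card_states (n : ℕ) :
    Real.logb 2 (Fintype.card (Fin n → Bool) : ℝ) = n := by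
  simp [Real.logb_pow]

theorem klU_synTPM (n : ℕ) {x : ℝ} (hx : x ∈ Set.Ioo (0 : ℝ) 1) (s : Fin n → Bool) :
    klU (synTPM n x s) = n * (1 + (1 - x) * Real.logb 2 (1 - x) + x * Real.logb 2 x) := by
  have hlog : ∀ s' : Fin n → Bool,
      Real.logb 2 (synTPM n x s s' / (1 / (Fintype.card (Fin n → Bool) : ℝ))) =
        ∑ j, (Real.logb 2 (bitKernel x (s j) (s' j)) + 1) := fun s' => by
    have hpos : 0 < synTPM n x s s' := by
      rw [synTPM_eq_prod]
      exact Finset.prod_pos fun j _ => bitKernel_pos hx _ _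
    rw [div_div_eq_mul_div, div_one, Real.logb_mul hpos.ne' (by simp), logb_card_states,
      synTPM_eq_prod, Real.logb_prod _ _ fun j _ => (bitKernel_pos hx _ _).ne',
      Finset.sum_add_distrib]
    simp
  unfold klU
  simp_rw [hlog, synTPM_eq_prod]
  rw [sum_prod_mul_sum_eq (fun j b => bitKernel x (s j) b)
    (fun j b => Real.logb 2 (bitKernel x (s j) b) + 1) fun j => sum_bitKernel x (s j)]
  have hbit : ∀ a : Bool, ∑ b, bitKernel x a b * (Real.logb 2 (bitKernel x a b) + 1) =
      1 + (1 - x) * Real.logb 2 (1 - x) + x * Real.logb 2 x := fun a => by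
    cases a <;> simp [bitKernel] <;> ring
  simp only [hbit, Finset.sum_const, Finset.card_univ, Fintype.card_fin, nsmul_eq_mul]

theorem degeneracy_synTPM (n : ℕ) (x : ℝ) : degeneracy (synTPM n x) = 0 := by
  simp [degeneracy, klU, sum_synTPM_column]

/-- For the synthetic symmetric TPM on 2ⁿ states with parameter x ∈ (0,1):
degeneracy = 0 and EI = n·(1 + (1-x)log₂(1-x) + x log₂ x). -/
theorem synTPM_EI (n : ℕ) (hn : 1 ≤ n) (x : ℝ) (hx : x ∈ Set.Ioo (0:ℝ) 1) :
    degeneracy (synTPM n x) = 0 ∧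
    EI (synTPM n x) = n * (1 + (1 - x) * Real.logb 2 (1 - x) + x * Real.logb 2 x) := by
  refine ⟨degeneracy_synTPM n x, ?_⟩
  have hn0 : (n : ℝ) ≠ 0 := Nat.cast_ne_zero.mpr (by omega)
  have hcard : (Fintype.card (Fin n → Bool) : ℝ) ≠ 0 := by simp
  unfold EI determinism
  simp_rw [degeneracy_synTPM, klU_synTPM n hx, logb_card_states]
  rw [Finset.sum_const, Finset.card_univ, nsmul_eq_mul]
  field_simp
  ring
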